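/- (Proposition 1: eliminating the flow conservation constraint from the optimal power flow problem with storage and generation) Consider a connected oriented graph on n nodes (n ≥ 2) and m arcs with oriented incidence matrix 𝔍, set μ = m − n + 1, and let B be a real μ×m matrix with 𝔍·Bᵀ = 0 and rank B = μ. Fix a distinguished node v_last and, for every other node i, let x̄_i ∈ ℝ^m be the signed indicator vector of some walk from node i to node v_last; for δ, u, d ∈ ℝ^n define xᵖ(δ, u, d) := Σ_{i ≠ v_last} (δ_i + u_i + d_i)·x̄_i. Fix a horizon T ≥ 1, loads d(t) ∈ ℝ^n for t = 1,…,T, cost functions g_i : ℝ → ℝ and φ_j : ℝ → ℝ, dissipation factors λ_i ∈ (0,1], a matrix 𝐁 ∈ ℝ^{n×n}, initial storage s(1) ∈ ℝ^n, and bounds δ̲, δ̄, u̲, ū, s̲, s̄ ∈ ℝ^n and 𝖻, 𝖼 ∈ ℝ^m. Call (x, δ, u, s, θ), with x(t) ∈ ℝ^m and δ(t), u(t), s(t), θ(t) ∈ ℝ^n, feasible for the original problem if for every t: 𝔍·x(t) = δ(t) + u(t) + d(t); s_i(t+1) = λ_i s_i(t) + u_i(t) for all i; for every arc k, 𝐁_{tail(k),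 head(k)}·(θ_{tail(k)}(t) − θ_{head(k)}(t)) = x_k(t); δ̲_i ≤ δ_i(t) ≤ δ̄_i, u̲_i ≤ u_i(t) ≤ ū_i, s̲_i ≤ s_i(t) ≤ s̄_i for all i; and 𝖻_k ≤ x_k(t) ≤ 𝖼_k for all k; its cost is (1/T)·Σ_{t=1}^{T} (Σ_{i=1}^{n} g_i(δ_i(t)) + Σ_{k=1}^{m} φ_k(x_k(t))). Call (z, δ, u, s, θ), with z(t) ∈ ℝ^μ, feasible for the reduced problem if for every t the tuple obtained by setting x(t) = Bᵀ·z(t) + xᵖ(δ(t), u(t), d(t)) satisfies all the above constraints except the flow conservation equation, together with the balance constraint Σ_{i=1}^{n} (δ_i(t) + u_i(t) + d_i(t)) = 0; its cost is the cost of that tuple. Then: if (z⋆, δ⋆, u⋆, s⋆, θ⋆) is a minimizer of the reduced problem over its feasible set, the tuple (x⋆, δ⋆, u⋆, s⋆, θ⋆) with x⋆(t) = Bᵀ·z⋆(t) + xᵖ(δ⋆(t), u⋆(t), d(t)) is a minimizer of the original problem over its feasible set. -/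

import Mathlib

/-- The oriented incidence matrix of an oriented graph given by `tail, head`. -/
def incMat (n m : ℕ) (tail head : Fin m → Fin n) : Matrix (Fin n) (Fin m) ℝ :=
  Matrix.of fun i j => if i = tail j then 1 else if i = head j then -1 else 0

/-- `x` is the signed indicator vector of a walk from `u` to `w`. -/
def IsWalkVec (n m : ℕ) (tail head : Fin m → Fin n) (u w : Fin n)
    (x : Fin m → ℝ) : Prop :=
  ∃ (k : ℕ) (v : Fin (k + 1) → Fin n) (a : Fin k → Fin m) (σ : Fin k → ℝ),
    v 0 = u ∧ v (Fin.last k) = w ∧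
    (∀ i : Fin k,
      (σ i = 1 ∧ tail (a i) = v i.castSucc ∧ head (a i) = v i.succ) ∨
      (σ i = -1 ∧ head (a i) = v i.castSucc ∧ tail (a i) = v i.succ)) ∧
    (∀ j : Fin m, x j = ∑ i : Fin k, if a i = j then σ i else 0)

/-- The oriented graph is connected: every pair of nodes is related by the
reflexive–transitive closure of "there is an arc between them". -/
def GraphConnected (n m : ℕ) (tail head : Fin m → Fin n) : Prop :=
  ∀ a b : Fin n, Relation.ReflTransGen
    (fun p q => ∃ j : Fin m, (tail j = p ∧ head j = q) ∨ (tail j = q ∧ head j = p)) a b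

/-- Particular solution `xᵖ(δ, u, d) = ∑_{i ≠ v_last} (δ_i + u_i + d_i) • x̄_i`. -/
noncomputable def xpart (n m : ℕ) (vlast : Fin n) (xb : Fin n → Fin m → ℝ)
    (δ u d : Fin n → ℝ) : Fin m → ℝ :=
  ∑ i ∈ Finset.univ.erase vlast, (δ i + u i + d i) • xb i

/-- All the constraints of the optimal power flow problem at time `t` except the flow
conservation equation: storage dynamics, DC power flow, bounds on generation,
charge/discharge, storage level, and arc capacities. -/
def NonFlowCons (n m : ℕ) (tail head : Fin m → Fin n)
    (lam : Fin n → ℝ) (Bmat : Matrix (Fin n) (Fin n) ℝ)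
    (δlo δhi ulo uhi slo shi : Fin n → ℝ) (blo chi : Fin m → ℝ)
    (t : ℕ) (x : ℕ → Fin m → ℝ) (δ u s θ : ℕ → Fin n → ℝ) : Prop :=
  (∀ i : Fin n, s (t + 1) i = lam i * s t i + u t i) ∧
  (∀ k : Fin m, Bmat (tail k) (head k) * (θ t (tail k) - θ t (head k)) = x t k) ∧
  (∀ i : Fin n, δlo i ≤ δ t i ∧ δ t i ≤ δhi i) ∧
  (∀ i : Fin n, ulo i ≤ u t i ∧ u t i ≤ uhi i) ∧
  (∀ i : Fin n, slo i ≤ s t i ∧ s t i ≤ shi i) ∧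
  (∀ k : Fin m, blo k ≤ x t k ∧ x t k ≤ chi k)

/-- The cost `(1/T)·∑_{t<T} (∑_i g_i(δ_i(t)) + ∑_k φ_k(x_k(t)))`. -/
noncomputable def costFun (n m T : ℕ) (g : Fin n → ℝ → ℝ) (φ : Fin m → ℝ → ℝ)
    (x : ℕ → Fin m → ℝ) (δ : ℕ → Fin n → ℝ) : ℝ :=
  (1 / (T : ℝ)) * ∑ t ∈ Finset.range T,
    ((∑ i : Fin n, g i (δ t i)) + ∑ k : Fin m, φ k (x t k))

/-- Each column of the incidence matrix is a difference of two unit vectors. -/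
theorem incMat_apply_eq_sub {n m : ℕ} {tail head : Fin m → Fin n} {j : Fin m}
    (h : tail j ≠ head j) (i : Fin n) :
    incMat n m tail head i j =
      (Pi.single (tail j) 1 : Fin n → ℝ) i - (Pi.single (head j) 1 : Fin n → ℝ) i := by
  simp only [incMat, Matrix.of_apply, Pi.single_apply]
  grind

/-- The divergence of any flow sums to zero over the nodes. -/
theorem sum_incMat_mulVec {n m : ℕ} {tail head : Fin m → Fin n}
    (h : ∀ j, tail j ≠ head j) (x : Fin m → ℝ) :
    ∑ i, (incMat n m tail head).mulVec x i = 0 := by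
  simp only [Matrix.mulVec, dotProduct]
  rw [Finset.sum_comm]
  refine Finset.sum_eq_zero fun j _ => ?_
  simp [← Finset.sum_mul, incMat_apply_eq_sub (h j), Finset.sum_sub_distrib]

/-- The incidence matrix sends the signed indicator vector of a walk from `u` to `w`
to the difference of the unit vectors at `u` and `w`. -/
theorem IsWalkVec.incMat_mulVec {n m : ℕ} {tail head : Fin m → Fin n}
    (h : ∀ j, tail j ≠ head j) {u w : Fin n} {x : Fin m → ℝ}
    (hx : IsWalkVec n m tail head u w x) :
    (incMat n m tail head).mulVec x = Pi.single u 1 - Pi.single w 1 := by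
  obtain ⟨k, v, a, σ, hu, hw, hstep, hxj⟩ := hx
  ext i
  set f : Fin (k + 1) → ℝ := fun l => (Pi.single (v l) 1 : Fin n → ℝ) i with hf
  have key : (incMat n m tail head).mulVec x i = ∑ l : Fin k, (f l.castSucc - f l.succ) := by
    simp only [Matrix.mulVec, dotProduct, hxj, Finset.mul_sum]
    rw [Finset.sum_comm]
    refine Finset.sum_congr rfl fun l _ => ?_
    simp only [mul_ite, mul_zero, Finset.sum_ite_eq, Finset.mem_univ, if_true,
      incMat_apply_eq_sub (h (a l))]
    rcases hstep l with ⟨hs, ht, hh⟩ | ⟨hs, hh, ht⟩ <;> simp only [hs, ht, hh, hf] <;> ring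
  have h₁ := Fin.sum_univ_castSucc f
  have h₂ := Fin.sum_univ_succ f
  rw [key, Finset.sum_sub_distrib, Pi.sub_apply, ← hu, ← hw]
  change _ = f 0 - f (Fin.last k)
  linarith

/-- If injections are balanced, the particular solution `xpart` satisfies flow conservation. -/
theorem incMat_mulVec_xpart {n m : ℕ} {tail head : Fin m → Fin n}
    (h : ∀ j, tail j ≠ head j) {vlast : Fin n} {xb : Fin n → Fin m → ℝ}
    (hxb : ∀ i, i ≠ vlast → IsWalkVec n m tail head i vlast (xb i))
    {δ u d : Fin n → ℝ} (hbal : ∑ i, (δ i + u i + d i) = 0) :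
    (incMat n m tail head).mulVec (xpart n m vlast xb δ u d) =
      fun i => δ i + u i + d i := by
  have hterm : ∀ i ∈ Finset.univ.erase vlast,
      (incMat n m tail head).mulVec ((δ i + u i + d i) • xb i) =
        (δ i + u i + d i) • (Pi.single i 1 - Pi.single vlast 1) := fun i hi => by
    rw [Matrix.mulVec_smul, (hxb i (Finset.ne_of_mem_erase hi)).incMat_mulVec h]
  rw [xpart, Matrix.mulVec_sum, Finset.sum_congr rfl hterm,
    Finset.sum_erase _ (by simp)]
  ext l
  simp [Finset.sum_apply, mul_sub, Finset.sum_sub_distrib, Pi.single_apply, hbal]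

/-- If every node has a walk to `vlast`, the incidence matrix has rank at least `n - 1`. -/
theorem le_rank_incMat_add_one {n m : ℕ} {tail head : Fin m → Fin n}
    (h : ∀ j, tail j ≠ head j) {vlast : Fin n} {xb : Fin n → Fin m → ℝ}
    (hxb : ∀ i, i ≠ vlast → IsWalkVec n m tail head i vlast (xb i)) :
    n ≤ (incMat n m tail head).rank + 1 := by
  set R := LinearMap.range (incMat n m tail head).mulVecLin
  set S := Submodule.span ℝ {(Pi.single vlast 1 : Fin n → ℝ)}
  have htop : R ⊔ S = ⊤ := by
    rw [eq_top_iff, ← (Pi.basisFun ℝ (Fin n)).span_eq, Submodule.span_le]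
    rintro _ ⟨i, rfl⟩
    have hS : (Pi.single vlast 1 : Fin n → ℝ) ∈ R ⊔ S :=
      Submodule.mem_sup_right (Submodule.mem_span_singleton_self _)
    rw [Pi.basisFun_apply, SetLike.mem_coe]
    by_cases hi : i = vlast
    · rwa [hi]
    · have hR : (Pi.single i 1 - Pi.single vlast 1 : Fin n → ℝ) ∈ R ⊔ S :=
        Submodule.mem_sup_left ⟨xb i, (hxb i hi).incMat_mulVec h⟩
      simpa using add_mem hR hS
  calc n = Module.finrank ℝ ↥(R ⊔ S) := by rw [htop, finrank_top, Module.finrank_fin_fun]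
    _ ≤ Module.finrank ℝ R + Module.finrank ℝ S := Submodule.finrank_add_le_finrank_add_finrank R S
    _ ≤ (incMat n m tail head).rank + 1 := by
      gcongr
      · exact le_rfl
      · simpa using finrank_span_le_card (R := ℝ) {(Pi.single vlast 1 : Fin n → ℝ)}

/-- If `A * Bᵀ = 0` and the ranks of `A` and `B` add up to at least the number of columns,
every vector in the kernel of `A` is a combination of the rows of `B`. -/
theorem Matrix.exists_transpose_mulVec_of_mulVec_eq_zero {n m μ : ℕ}
    {A : Matrix (Fin n) (Fin m) ℝ} {B : Matrix (Fin μ) (Fin m) ℝ}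
    (hAB : A * B.transpose = 0) (hrank : m ≤ A.rank + B.rank)
    {y : Fin m → ℝ} (hy : A.mulVec y = 0) : ∃ z, B.transpose.mulVec z = y := by
  have hle : LinearMap.range B.transpose.mulVecLin ≤ LinearMap.ker A.mulVecLin := by
    rintro _ ⟨z, rfl⟩
    rw [LinearMap.mem_ker, Matrix.mulVecLin_apply, Matrix.mulVecLin_apply, Matrix.mulVec_mulVec,
      hAB, Matrix.zero_mulVec]
  have hnull := A.mulVecLin.finrank_range_add_finrank_ker
  rw [Module.finrank_fin_fun] at hnull
  have hB : B.rank = Module.finrank ℝ (LinearMap.range B.transpose.mulVecLin) :=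
    B.rank_transpose.symm
  have hA : A.rank = Module.finrank ℝ (LinearMap.range A.mulVecLin) := rfl
  have heq := Submodule.eq_of_le_of_finrank_le hle (by omega)
  have hmem : y ∈ LinearMap.ker A.mulVecLin := hy
  rw [← heq] at hmem
  exact hmem

/-- Proposition 1: if `(z⋆, δ⋆, u⋆, s⋆, θ⋆)` minimizes the reduced
optimal power flow problem (flow conservation eliminated via the cycle basis matrix
`B` and the particular solution `xᵖ`, with the balance constraint added), then
`(x⋆, δ⋆, u⋆, s⋆, θ⋆)` with `x⋆(t) = Bᵀ·z⋆(t) + xᵖ(δ⋆(t), u⋆(t), d(t))` minimizes the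
original optimal power flow problem with storage and generation. -/
theorem opf_storage_generation_eliminate_flow_conservation
    (n m : ℕ) (hn : 2 ≤ n) (hm : 1 ≤ m)
    (tail head : Fin m → Fin n) (hth : ∀ j : Fin m, tail j ≠ head j)
    (hconn : GraphConnected n m tail head)
    (μ : ℕ) (hμ : μ = m - n + 1)
    (B : Matrix (Fin μ) (Fin m) ℝ)
    (hB : incMat n m tail head * B.transpose = 0)
    (hrank : B.rank = μ)
    (vlast : Fin n) (xb : Fin n → Fin m → ℝ)
    (hxb : ∀ i : Fin n, i ≠ vlast → IsWalkVec n m tail head i vlast (xb i))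
    (T : ℕ) (hT : 1 ≤ T)
    (d : ℕ → Fin n → ℝ)
    (g : Fin n → ℝ → ℝ) (φ : Fin m → ℝ → ℝ)
    (lam : Fin n → ℝ) (hlam : ∀ i : Fin n, 0 < lam i ∧ lam i ≤ 1)
    (Bmat : Matrix (Fin n) (Fin n) ℝ)
    (sInit : Fin n → ℝ)
    (δlo δhi ulo uhi slo shi : Fin n → ℝ) (blo chi : Fin m → ℝ)
    (zs : ℕ → Fin μ → ℝ) (δs us ss θs : ℕ → Fin n → ℝ)
    (xs : ℕ → Fin m → ℝ)
    (hxs : ∀ t : ℕ,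
      xs t = B.transpose.mulVec (zs t) + xpart n m vlast xb (δs t) (us t) (d t))
    -- `(z⋆, δ⋆, u⋆, s⋆, θ⋆)` is feasible for the reduced problem:
    (hfeas : ss 0 = sInit ∧ ∀ t < T,
        (∑ i : Fin n, (δs t i + us t i + d t i)) = 0 ∧
        NonFlowCons n m tail head lam Bmat δlo δhi ulo uhi slo shi blo chi
          t xs δs us ss θs)
    -- `(z⋆, δ⋆, u⋆, s⋆, θ⋆)` minimizes the cost over the reduced feasible set:
    (hmin : ∀ (z : ℕ → Fin μ → ℝ) (δ u s θ : ℕ → Fin n → ℝ),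
        (s 0 = sInit ∧ ∀ t < T,
          (∑ i : Fin n, (δ t i + u t i + d t i)) = 0 ∧
          NonFlowCons n m tail head lam Bmat δlo δhi ulo uhi slo shi blo chi t
            (fun t' => B.transpose.mulVec (z t') +
              xpart n m vlast xb (δ t') (u t') (d t')) δ u s θ) →
        costFun n m T g φ xs δs ≤
          costFun n m T g φ
            (fun t' => B.transpose.mulVec (z t') +
              xpart n m vlast xb (δ t') (u t') (d t')) δ) :
    -- conclusion: `(x⋆, δ⋆, u⋆, s⋆, θ⋆)` minimizes the original problem:
    ((ss 0 = sInit ∧ ∀ t < T,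
        ((incMat n m tail head).mulVec (xs t) = fun i => δs t i + us t i + d t i) ∧
        NonFlowCons n m tail head lam Bmat δlo δhi ulo uhi slo shi blo chi
          t xs δs us ss θs) ∧
      ∀ (x : ℕ → Fin m → ℝ) (δ u s θ : ℕ → Fin n → ℝ),
        (s 0 = sInit ∧ ∀ t < T,
          ((incMat n m tail head).mulVec (x t) = fun i => δ t i + u t i + d t i) ∧
          NonFlowCons n m tail head lam Bmat δlo δhi ulo uhi slo shi blo chi
            t x δ u s θ) →
        costFun n m T g φ xs δs ≤ costFun n m T g φ x δ) := by
  have hJB : ∀ z, (incMat n m tail head).mulVec (B.transpose.mulVec z) = 0 := fun z => by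
    rw [Matrix.mulVec_mulVec, hB, Matrix.zero_mulVec]
  refine ⟨⟨hfeas.1, fun t ht => ⟨?_, (hfeas.2 t ht).2⟩⟩, fun x δ u s θ hx => ?_⟩
  · rw [hxs, Matrix.mulVec_add, hJB, zero_add,
      incMat_mulVec_xpart hth hxb (hfeas.2 t ht).1]
  have hbal : ∀ t < T, ∑ i, (δ t i + u t i + d t i) = 0 := fun t ht => by
    simpa [(hx.2 t ht).1] using sum_incMat_mulVec hth (x t)
  have hrank_le : m ≤ (incMat n m tail head).rank + B.rank := by
    have := le_rank_incMat_add_one hth hxb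
    omega
  have hz : ∀ t, ∃ z, t < T →
      B.transpose.mulVec z + xpart n m vlast xb (δ t) (u t) (d t) = x t := fun t => by
    by_cases ht : t < T
    · obtain ⟨z, hz⟩ := Matrix.exists_transpose_mulVec_of_mulVec_eq_zero hB hrank_le
        (y := x t - xpart n m vlast xb (δ t) (u t) (d t)) (by
          rw [Matrix.mulVec_sub, (hx.2 t ht).1, incMat_mulVec_xpart hth hxb (hbal t ht),
            sub_self])
      exact ⟨z, fun _ => by rw [hz, sub_add_cancel]⟩
    · exact ⟨0, fun h => absurd h ht⟩
  choose z hz using hz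
  refine (hmin z δ u s θ ⟨hx.1, fun t ht => ⟨hbal t ht, ?_⟩⟩).trans_eq ?_
  · simpa only [NonFlowCons, hz t ht] using (hx.2 t ht).2
  · unfold costFun
    congr 1
    refine Finset.sum_congr rfl fun t ht => ?_
    simp only [hz t (Finset.mem_range.mp ht)]
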